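/- Let E be a real Banach space and A : E × ℝ → ℝ a continuously differentiable function such that |∂A/∂f (x, f)| ≤ L and |A(x, f)| ≤ M for all (x, f) ∈ E × ℝ, where ∂A/∂f denotes the partial derivative in the second variable and L, M ≥ 0 are constants. Let γ_f, γ_W > 0 with γ_f > γ_W · L. Then for every x ∈ E there exists a unique real number f̃(x) satisfying γ_f · f̃(x) + γ_W · A(x, f̃(x)) = 0; the resulting function f̃ : E → ℝ is continuously differentiable; and |f̃(x)| ≤ γ_W · M / γ_f for all x. -/

import Mathlib

/-- core analytic step of Proposition 5.1 of the paper: let `A` be a `C¹`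
function on `E × ℝ` with `|∂A/∂f| ≤ L` and `|A| ≤ M`, and let `γ_f > γ_W · L` with
`γ_f, γ_W > 0`.  Then for each `x` there is a unique `f̃(x)` with
`γ_f f̃(x) + γ_W A(x, f̃(x)) = 0`; the function `f̃` is `C¹` and `|f̃(x)| ≤ γ_W M / γ_f`. -/
theorem implicit_optimal_signal {E : Type*} [NormedAddCommGroup E] [NormedSpace ℝ E]
    [CompleteSpace E]
    (A : E × ℝ → ℝ) (hA : ContDiff ℝ 1 A)
    (L M : ℝ) (hL : 0 ≤ L) (hM : 0 ≤ M)
    (hderiv : ∀ (x : E) (f : ℝ), |deriv (fun s : ℝ => A (x, s)) f| ≤ L)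
    (hbound : ∀ (x : E) (f : ℝ), |A (x, f)| ≤ M)
    (γf γW : ℝ) (hγf : 0 < γf) (hγW : 0 < γW) (hratio : γW * L < γf) :
    ∃ ftilde : E → ℝ,
      (∀ x : E, γf * ftilde x + γW * A (x, ftilde x) = 0) ∧
      (∀ (x : E) (y : ℝ), γf * y + γW * A (x, y) = 0 → y = ftilde x) ∧
      ContDiff ℝ 1 ftilde ∧
      (∀ x : E, |ftilde x| ≤ γW * M / γf) := by
  have hAd : Differentiable ℝ A := hA.differentiable (by norm_num)
  have hder : ∀ (x : E) (s : ℝ), HasDerivAt (fun s : ℝ => γf * s + γW * A (x, s))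
      (γf + γW * deriv (fun s : ℝ => A (x, s)) s) s := by
    intro x s
    have h1 : DifferentiableAt ℝ (fun s : ℝ => A (x, s)) s := by fun_prop
    have h2 := ((hasDerivAt_id s).const_mul γf).add (h1.hasDerivAt.const_mul γW)
    rw [mul_one] at h2
    exact h2
  have hpos : ∀ (x : E) (s : ℝ), 0 < γf + γW * deriv (fun s : ℝ => A (x, s)) s := by
    intro x s
    have h := (abs_le.1 (hderiv x s)).1
    nlinarith
  have hmono : ∀ x : E, StrictMono (fun s : ℝ => γf * s + γW * A (x, s)) := fun x =>
    strictMono_of_deriv_pos fun s => by rw [(hder x s).deriv]; exact hpos x s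
  have hex : ∀ x : E, ∃ y : ℝ, γf * y + γW * A (x, y) = 0 ∧ |y| ≤ γW * M / γf := by
    intro x
    have hR : 0 ≤ γW * M / γf := by positivity
    have hR' : γf * (γW * M / γf) = γW * M := by field_simp
    have hc : Continuous (fun s : ℝ => γf * s + γW * A (x, s)) := by
      have := hA.continuous
      fun_prop
    obtain ⟨y, hy, hy0⟩ := intermediate_value_Icc (a := -(γW * M / γf)) (b := γW * M / γf)
      (by linarith) hc.continuousOn (show (0 : ℝ) ∈ _ from by
        have h1 := (abs_le.1 (hbound x (-(γW * M / γf)))).2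
        have h2 := (abs_le.1 (hbound x (γW * M / γf))).1
        constructor
        · show γf * (-(γW * M / γf)) + γW * A (x, -(γW * M / γf)) ≤ 0
          nlinarith
        · show 0 ≤ γf * (γW * M / γf) + γW * A (x, γW * M / γf)
          nlinarith)
    exact ⟨y, hy0, abs_le.2 hy⟩
  choose g hg hgb using hex
  have huniq : ∀ (x : E) (y : ℝ), γf * y + γW * A (x, y) = 0 → y = g x := fun x y hy =>
    (hmono x).injective (hy.trans (hg x).symm)
  refine ⟨g, hg, huniq, ?_, hgb⟩
  rw [contDiff_iff_contDiffAt]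
  intro x
  set F : E × ℝ → ℝ := fun v => γf * v.2 + γW * A v with hF
  have hFc : ContDiff ℝ 1 F := by fun_prop
  have hFat : ContDiffAt ℝ 1 F (x, g x) := hFc.contDiffAt
  have hinv : (fderiv ℝ F (x, g x) ∘L .inr ℝ E ℝ).IsInvertible := by
    have hd : HasFDerivAt F (fderiv ℝ F (x, g x)) (x, g x) :=
      (hFc.differentiable (by norm_num) _).hasFDerivAt
    have h2 : HasDerivAt (fun s : ℝ => γf * s + γW * A (x, s))
        ((fderiv ℝ F (x, g x) ∘L .inr ℝ E ℝ) 1) (g x) :=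
      (hd.comp (g x) (hasFDerivAt_prodMk_right x (g x))).hasDerivAt
    have h3 := h2.unique (hder x (g x))
    have h4 : (fderiv ℝ F (x, g x) ∘L .inr ℝ E ℝ) 1 ≠ 0 := by
      rw [h3]; exact (hpos x (g x)).ne'
    refine ⟨ContinuousLinearEquiv.unitsEquivAut ℝ (Units.mk0 _ h4), ?_⟩
    ext
    simp
  refine (hFat.contDiffAt_implicitFunction one_ne_zero hinv).congr_of_eventuallyEq ?_
  filter_upwards [hFat.eventually_apply_implicitFunction one_ne_zero hinv] with z hz
  exact (huniq z _ (hz.trans (hg x))).symm
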